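/- (Pfaff-type recurrence for the q-Pfaff–Saalschütz sum) Let q be a nonzero complex number, let n ≥ 1 be an integer, and let a, b, c be nonzero complex numbers with (q;q)_n ≠ 0, (c;q)_n ≠ 0, and 1 − a b q^{m}/c ≠ 0 for every integer m with 1−n ≤ m ≤ 1. Define S_n(a,b,c;q) := ∑_{j=0}^{n} ((a;q)_j (b;q)_j (q^{-n};q)_j / ((q;q)_j (c;q)_j (a b q^{-n+1}/c;q)_j)) q^j. Then S_n(a,b,c;q) − S_{n−1}(a,b,c;q) = − (q^{-n+1}(1−a)(1−b)(1−abq/c) / ((1−c)(1−abq^{-n+1}/c)(1−abq^{-n+2}/c))) · S_{n−1}(aq,bq,cq;q), where S_{n−1}(aq,bq,cq;q) = ∑_{j=0}^{n−1} ((aq;q)_j (bq;q)_j (q^{-n+1};q)_j / ((q;q)_j (cq;q)_j (a b q^{-n+3}/c;q)_j)) q^j. -/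

import Mathlib

/-- The $q$-shifted factorial $(a;q)_m = \prod_{k=0}^{m-1}(1 - a q^k)$. -/
noncomputable def qPoch (q a : ℂ) (m : ℕ) : ℂ := ∏ k ∈ Finset.range m, (1 - a * q ^ k)

/-- The terminating $q$-Pfaff–Saalschütz sum
$S_n(a,b,c;q) = \sum_{j=0}^n \frac{(a;q)_j (b;q)_j (q^{-n};q)_j}
{(q;q)_j (c;q)_j (abq^{-n+1}/c;q)_j} q^j$. -/
noncomputable def Sps (q a b c : ℂ) (n : ℕ) : ℂ :=
  ∑ j ∈ Finset.range (n + 1),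
    qPoch q a j * qPoch q b j * qPoch q (q ^ (-(n : ℤ))) j /
      (qPoch q q j * qPoch q c j * qPoch q (a * b * q ^ (1 - (n : ℤ)) / c) j) * q ^ j

theorem qPoch_succ_right (q a : ℂ) (m : ℕ) :
    qPoch q a (m + 1) = qPoch q a m * (1 - a * q ^ m) :=
  Finset.prod_range_succ _ _

theorem qPoch_succ_left (q a : ℂ) (m : ℕ) :
    qPoch q a (m + 1) = (1 - a) * qPoch q (a * q) m := by
  unfold qPoch
  rw [Finset.prod_range_succ', mul_comm]
  congr 1
  · simp
  · exact Finset.prod_congr rfl fun k _ => by ring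

theorem qPoch_ne_zero_of_le {q a : ℂ} {m n : ℕ} (hmn : m ≤ n) (h : qPoch q a n ≠ 0) :
    qPoch q a m ≠ 0 := by
  unfold qPoch at *
  rw [Finset.prod_ne_zero_iff] at *
  exact fun k hk => h k (Finset.range_subset_range.mpr hmn hk)

/-- The contiguous relation between consecutive summands; here `p` plays the role of `q ^ (-n)`
and `x` that of `a * b * q ^ (1 - n) / c`. -/
theorem ps_summand_sub (q a b c p x : ℂ) (k : ℕ) (hp : p ≠ 0)
    (hqk : qPoch q q (k + 1) ≠ 0) (hck : qPoch q c (k + 1) ≠ 0)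
    (hx : qPoch q x (k + 2) ≠ 0) :
    qPoch q a (k + 1) * qPoch q b (k + 1) * qPoch q p (k + 1) /
        (qPoch q q (k + 1) * qPoch q c (k + 1) * qPoch q x (k + 1)) * q ^ (k + 1) -
      qPoch q a (k + 1) * qPoch q b (k + 1) * qPoch q (p * q) (k + 1) /
        (qPoch q q (k + 1) * qPoch q c (k + 1) * qPoch q (x * q) (k + 1)) * q ^ (k + 1)
      = -(p * q * (1 - a) * (1 - b) * (1 - x / p) / ((1 - c) * (1 - x) * (1 - x * q))) *
        (qPoch q (a * q) k * qPoch q (b * q) k * qPoch q (p * q) k /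
          (qPoch q q k * qPoch q (c * q) k * qPoch q (x * q * q) k) * q ^ k) := by
  have hY : qPoch q (x * q) (k + 1) = (1 - x * q) * qPoch q (x * q * q) k :=
    qPoch_succ_left q (x * q) k
  have hY' := qPoch_succ_right q (x * q) k
  rw [qPoch_succ_left, hY] at hx
  rw [hY] at hY'
  rw [qPoch_succ_right] at hqk
  rw [qPoch_succ_left] at hck
  rw [hY, qPoch_succ_left q a, qPoch_succ_left q b, qPoch_succ_left q c, qPoch_succ_left q p,
    qPoch_succ_left q x, qPoch_succ_right q q, qPoch_succ_right q (p * q)]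
  simp only [mul_ne_zero_iff] at hx hqk hck
  obtain ⟨hx0, hx1, hZ⟩ := hx
  obtain ⟨hQ, hqk⟩ := hqk
  obtain ⟨hc0, hC⟩ := hck
  have hYD := mul_ne_zero hx1 hZ
  rw [hY', mul_ne_zero_iff] at hYD
  obtain ⟨hY0, hD⟩ := hYD
  generalize qPoch q (x * q) k = Y at *
  generalize qPoch q (x * q * q) k = Z at *
  obtain rfl : Y = (1 - x * q) * Z / (1 - x * q * q ^ k) := by
    rw [eq_div_iff hD, hY']
  generalize qPoch q (a * q) k = A
  generalize qPoch q (b * q) k = B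
  generalize qPoch q (c * q) k = C at *
  generalize qPoch q (p * q) k = P
  generalize qPoch q q k = Q at *
  rw [pow_succ]
  generalize q ^ k = r at *
  field_simp
  ring

/-- Pfaff-type recurrence for the $q$-Pfaff–Saalschütz sum. -/
theorem ps_recurrence (q : ℂ) (hq : q ≠ 0) (n : ℕ) (hn : 1 ≤ n) (a b c : ℂ)
    (ha : a ≠ 0) (hb : b ≠ 0) (hc : c ≠ 0)
    (hqq : qPoch q q n ≠ 0) (hcn : qPoch q c n ≠ 0)
    (hab : ∀ m : ℤ, 1 - (n : ℤ) ≤ m → m ≤ 1 → 1 - a * b * q ^ m / c ≠ 0) :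
    Sps q a b c n - Sps q a b c (n - 1)
      = -(q ^ (1 - (n : ℤ)) * (1 - a) * (1 - b) * (1 - a * b * q / c) /
          ((1 - c) * (1 - a * b * q ^ (1 - (n : ℤ)) / c) * (1 - a * b * q ^ (2 - (n : ℤ)) / c)))
          * Sps q (a * q) (b * q) (c * q) (n - 1) := by
  obtain ⟨N, rfl⟩ : ∃ N, n = N + 1 := ⟨n - 1, by omega⟩
  have hz (m : ℤ) : q ^ (m + 1) = q ^ m * q := zpow_add_one₀ hq m
  obtain ⟨p, hp⟩ : ∃ p, p = q ^ (-((N + 1 : ℕ) : ℤ)) := ⟨_, rfl⟩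
  have hp0 : p ≠ 0 := hp ▸ zpow_ne_zero _ hq
  have e1 : q ^ (-(N : ℤ)) = p * q := by
    rw [hp, ← hz]; congr 1; push_cast; ring
  have e2 : q ^ (1 - ((N + 1 : ℕ) : ℤ)) = p * q := by
    rw [← e1]; congr 1; push_cast; ring
  have e3 : q ^ (1 - (N : ℤ)) = p * q * q := by
    rw [← e1, ← hz]; congr 1; ring
  have e4 : q ^ (2 - ((N + 1 : ℕ) : ℤ)) = p * q * q := by
    rw [← e3]; congr 1; push_cast; ring
  obtain ⟨x, hx⟩ : ∃ x, x = a * b * (p * q) / c := ⟨_, rfl⟩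
  have x1 : a * b * (p * q * q) / c = x * q := by rw [hx]; ring
  have x2 : a * q * (b * q) * (p * q * q) / (c * q) = x * q * q := by
    rw [hx]; field_simp
  have x3 : a * b * q / c = x / p := by rw [hx]; field_simp
  have hX : qPoch q x (N + 2) ≠ 0 := by
    refine Finset.prod_ne_zero_iff.mpr fun k hk => ?_
    have hk' := Finset.mem_range.mp hk
    have h := hab (-(N : ℤ) + k) (by push_cast; omega) (by omega)
    rwa [zpow_add₀ hq, e1, zpow_natCast,
      show a * b * (p * q * q ^ k) / c = x * q ^ k by rw [hx]; ring] at h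
  have hlast : qPoch q (p * q) (N + 1) = 0 := by
    rw [qPoch_succ_right, ← e1, zpow_neg, zpow_natCast, inv_mul_cancel₀ (pow_ne_zero _ hq)]
    simp
  simp only [Sps, Nat.add_sub_cancel, e1, e2, e3, e4, ← hp, ← hx, x1, x2, x3]
  have hext := Finset.sum_range_succ (fun j => qPoch q a j * qPoch q b j * qPoch q (p * q) j /
    (qPoch q q j * qPoch q c j * qPoch q (x * q) j) * q ^ j) (N + 1)
  simp only [hlast, mul_zero, zero_div, zero_mul, add_zero] at hext
  rw [← hext, ← Finset.sum_sub_distrib, Finset.sum_range_succ', Finset.mul_sum]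
  simp only [qPoch, Finset.range_zero, Finset.prod_empty, sub_self, add_zero]
  refine Finset.sum_congr rfl fun k hk => ?_
  have hk' := Finset.mem_range.mp hk
  exact ps_summand_sub q a b c p x k hp0 (qPoch_ne_zero_of_le (by omega) hqq)
    (qPoch_ne_zero_of_le (by omega) hcn) (qPoch_ne_zero_of_le (by omega) hX)
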